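/- arXiv:1712.10133 — 2 statements merged into one kernel-verified Lean document; each statement's English description precedes it below -/
import Mathlib

section
/- Let A be a Γ-C*-algebra, μ ∈ Prob(Γ), and τ a μ-stationary state on A. Then τ is the unique μ-stationary state on A if and only if for every a ∈ A, the Cesàro averages of convolutions converge uniformly to τ(a), i.e. ‖(1/n) ∑_{k=0}^{n-1} μ^k * a − τ(a)·1_A‖ → 0 as n → ∞, where μ * a = ∑_{g∈Γ} μ(g) g⁻¹·a and μ^k is the k-th convolution power of μ. -/
noncomputable section
open scoped ComplexOrder ENNReal
open MeasureTheory Filter Topology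
set_option linter.unusedSectionVars false
set_option maxHeartbeats 1000000
set_option synthInstance.maxHeartbeats 400000

namespace RW

/-- A probability distribution on a (countable discrete) group. -/
structure ProbOn (Γ : Type*) where
  w : Γ → ℝ
  nonneg : ∀ g, 0 ≤ w g
  hasSum : HasSum w 1

/-- `μ` is generating: the semigroup generated by its support is the whole group. -/
def ProbOn.Generating {Γ : Type*} [Group Γ] (μ : ProbOn Γ) : Prop :=
  ∀ g : Γ, ∃ l : List Γ, l ≠ [] ∧ (∀ x ∈ l, 0 < μ.w x) ∧ l.prod = g

/-- A state on a unital complex star algebra: a positive unital linear functional. -/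
structure AlgState (A : Type*) [Ring A] [StarRing A] [Algebra ℂ A] where
  toFun : A →ₗ[ℂ] ℂ
  map_one : toFun 1 = 1
  pos : ∀ a : A, 0 ≤ toFun (star a * a)

section CstarAct

variable {Γ : Type*} [Group Γ] {A : Type*} [Ring A] [StarRing A] [Algebra ℂ A]
  [MulSemiringAction Γ A]

/-- A `μ`-stationary state on a `Γ`-C*-algebra. -/
def IsStationaryStateAct (μ : ProbOn Γ) (τ : AlgState A) : Prop :=
  ∀ a : A, HasSum (fun g : Γ => (μ.w g : ℂ) * τ.toFun (g⁻¹ • a)) (τ.toFun a)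

/-- Bounded `μ`-harmonic functions. -/
def IsBddHarmonic (μ : ProbOn Γ) (f : Γ → ℂ) : Prop :=
  (∃ C : ℝ, ∀ g : Γ, ‖f g‖ ≤ C) ∧
  ∀ g : Γ, HasSum (fun h : Γ => (μ.w h : ℂ) * f (g * h)) (f g)

end CstarAct

section ConvOp

variable {Γ : Type*} [Group Γ] {A : Type*} [NormedRing A] [StarRing A] [NormedAlgebra ℂ A]
  [CompleteSpace A] [MulSemiringAction Γ A]

/-- The convolution operator `a ↦ μ * a = ∑_g μ(g) (g⁻¹ ⋅ a)`; its `k`-th iterate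
is convolution with the `k`-th convolution power `μ^k`. -/
def convOp (μ : ProbOn Γ) (a : A) : A := ∑' g : Γ, (μ.w g : ℂ) • (g⁻¹ • a)

end ConvOp

end RW

namespace RW

section HahnBanach

/-- A sublinear functional on a real vector space is attained at any given vector by a linear
functional which it dominates. -/
theorem exists_linearMap_le_sublinear {E : Type*} [AddCommGroup E] [Module ℝ E] (N : E → ℝ)
    (hsmul : ∀ c : ℝ, 0 < c → ∀ x, N (c • x) = c * N x)
    (hadd : ∀ x y, N (x + y) ≤ N x + N y) (x₀ : E) :
    ∃ g : E →ₗ[ℝ] ℝ, g x₀ = N x₀ ∧ ∀ x, g x ≤ N x := by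
  have hzero : N 0 = 0 := by grind [hsmul 2 (by norm_num) 0, smul_zero]
  have H : ∀ c : ℝ, c • x₀ = 0 → (RingHom.id ℝ) c • N x₀ = 0 := by
    intro c hc
    rcases smul_eq_zero.1 hc with rfl | rfl <;> simp [hzero]
  obtain ⟨g, hg, hgN⟩ := exists_extension_of_le_sublinear
    (LinearPMap.mkSpanSingleton' x₀ (N x₀) H) N hsmul hadd (by
      rintro ⟨x, hx⟩
      obtain ⟨c, rfl⟩ := Submodule.mem_span_singleton.1 hx
      rw [LinearPMap.mkSpanSingleton'_apply]
      simp only [RingHom.id_apply, smul_eq_mul]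
      rcases lt_trichotomy c 0 with hc | rfl | hc
      · have h1 := hsmul (-c) (by linarith) x₀
        have h2 := hadd (c • x₀) (-c • x₀)
        rw [neg_smul, add_neg_cancel, hzero, ← neg_smul, h1] at h2
        linarith
      · simp [hzero]
      · exact (hsmul c hc x₀).ge)
  refine ⟨g, ?_, hgN⟩
  exact (hg ⟨x₀, Submodule.mem_span_singleton_self x₀⟩).trans
    (LinearPMap.mkSpanSingleton'_apply_self ..)

end HahnBanach

section States

variable {A : Type*} [CStarAlgebra A] [PartialOrder A] [StarOrderedRing A]

theorem AlgState.nonneg (τ : AlgState A) {a : A} (ha : 0 ≤ a) : 0 ≤ τ.toFun a := by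
  obtain ⟨b, rfl⟩ := CStarAlgebra.nonneg_iff_eq_star_mul_self.1 ha
  exact τ.pos b

/-- A state as a positive linear map. -/
def AlgState.toPositive (τ : AlgState A) : A →ₚ[ℂ] ℂ :=
  PositiveLinearMap.mk₀ τ.toFun fun _ => τ.nonneg

theorem AlgState.continuous (τ : AlgState A) : Continuous τ.toFun :=
  map_continuous τ.toPositive

/-- The state extending a positive unital real functional on the selfadjoint elements. -/
def stateOfSelfAdjoint (g : selfAdjoint A →ₗ[ℝ] ℝ) (hone : g 1 = 1)
    (hpos : ∀ x : selfAdjoint A, 0 ≤ (x : A) → 0 ≤ g x) : AlgState A where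
  toFun :=
    { toFun := fun a => (g (realPart a) : ℂ) + Complex.I * g (imaginaryPart a)
      map_add' := fun a b => by simp only [map_add]; push_cast; ring
      map_smul' := fun z a => by
        simp only [realPart_smul, imaginaryPart_smul, map_add, map_sub, map_smul, smul_eq_mul,
          RingHom.id_apply]
        push_cast
        conv_rhs => rw [← Complex.re_add_im z]
        linear_combination (-(z.im : ℂ) * g (imaginaryPart a)) * Complex.I_sq }
  map_one := by
    have h1 : realPart (1 : A) = 1 := Subtype.ext (by simp)
    have h2 : imaginaryPart (1 : A) = 0 := (IsSelfAdjoint.one A).imaginaryPart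
    simp [h1, h2, hone]
  pos := fun a => by
    have hsa : IsSelfAdjoint (star a * a) := IsSelfAdjoint.star_mul_self a
    have h1 : 0 ≤ g (realPart (star a * a)) :=
      hpos _ (by rw [hsa.coe_realPart]; exact star_mul_self_nonneg a)
    simpa [hsa.imaginaryPart] using h1

theorem stateOfSelfAdjoint_apply (g : selfAdjoint A →ₗ[ℝ] ℝ) (hone : g 1 = 1)
    (hpos : ∀ x : selfAdjoint A, 0 ≤ (x : A) → 0 ≤ g x) (a : A) :
    (stateOfSelfAdjoint g hone hpos).toFun a
      = (g (realPart a) : ℂ) + Complex.I * g (imaginaryPart a) := rfl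

theorem norm_le_of_le_algebraMap [Nontrivial A] {a : A} (ha : IsSelfAdjoint a) {r : ℝ}
    (h₁ : a ≤ algebraMap ℝ A r) (h₂ : -a ≤ algebraMap ℝ A r) : ‖a‖ ≤ r := by
  rw [le_algebraMap_iff_spectrum_le] at h₁
  rw [neg_le, ← map_neg, algebraMap_le_iff_le_spectrum] at h₂
  rcases CStarAlgebra.norm_or_neg_norm_mem_spectrum ha with h | h
  · exact h₁ _ h
  · have := h₂ _ h
    linarith

end States

section AsymptoticBounds

variable {A : Type*} [CStarAlgebra A] [PartialOrder A] [StarOrderedRing A]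

/-- The real numbers that eventually bound `S n x` from above. -/
def eventualBounds (S : ℕ → A →ₚ[ℂ] A) (x : selfAdjoint A) : Set ℝ :=
  {t | ∀ᶠ n in atTop, S n (x : A) ≤ algebraMap ℝ A t}

theorem map_algebraMap_real (S : A →ₚ[ℂ] A) (h : S 1 = 1) (t : ℝ) :
    S (algebraMap ℝ A t) = algebraMap ℝ A t := by
  rw [Algebra.algebraMap_eq_smul_one, S.map_smul_of_tower, h]

variable {S : ℕ → A →ₚ[ℂ] A}

theorem mem_eventualBounds_of_le (hS : ∀ᶠ n in atTop, S n 1 = 1) {x : selfAdjoint A} {t : ℝ}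
    (h : (x : A) ≤ algebraMap ℝ A t) : t ∈ eventualBounds S x := by
  filter_upwards [hS] with n hn
  rw [← map_algebraMap_real (S n) hn]
  exact OrderHomClass.mono (S n) h

theorem neg_norm_le_of_mem_eventualBounds [Nontrivial A] (hS : ∀ᶠ n in atTop, S n 1 = 1)
    {x : selfAdjoint A} {t : ℝ} (h : t ∈ eventualBounds S x) : -‖(x : A)‖ ≤ t := by
  obtain ⟨n, h₁, hn⟩ := (hS.and h).exists
  have h₂ := OrderHomClass.mono (S n) x.2.neg_algebraMap_norm_le_self
  rw [map_neg, map_algebraMap_real _ h₁, ← map_neg] at h₂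
  exact (algebraMap_le_algebraMap (β := A)).1 (h₂.trans hn)

theorem bddBelow_eventualBounds [Nontrivial A] (hS : ∀ᶠ n in atTop, S n 1 = 1)
    (x : selfAdjoint A) : BddBelow (eventualBounds S x) :=
  ⟨_, fun _ => neg_norm_le_of_mem_eventualBounds hS⟩

theorem nonempty_eventualBounds (hS : ∀ᶠ n in atTop, S n 1 = 1)
    (x : selfAdjoint A) : (eventualBounds S x).Nonempty :=
  ⟨_, mem_eventualBounds_of_le hS x.2.le_algebraMap_norm_self⟩

theorem add_mem_eventualBounds {x y : selfAdjoint A} {s t : ℝ} (hs : s ∈ eventualBounds S x)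
    (ht : t ∈ eventualBounds S y) : s + t ∈ eventualBounds S (x + y) := by
  filter_upwards [hs, ht] with n h₁ h₂
  rw [AddSubgroup.coe_add, map_add, map_add]
  exact add_le_add h₁ h₂

theorem smul_mem_eventualBounds {x : selfAdjoint A} {c t : ℝ} (hc : 0 ≤ c)
    (ht : t ∈ eventualBounds S x) : c * t ∈ eventualBounds S (c • x) := by
  filter_upwards [ht] with n h
  rw [selfAdjoint.val_smul, (S n).map_smul_of_tower, map_mul, ← Algebra.smul_def]
  exact smul_le_smul_of_nonneg_left h hc

/-- The asymptotic upper bound of the sequence `S n x`. -/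
def asympSup (S : ℕ → A →ₚ[ℂ] A) (x : selfAdjoint A) : ℝ := sInf (eventualBounds S x)

theorem asympSup_le [Nontrivial A] (hS : ∀ᶠ n in atTop, S n 1 = 1) {x : selfAdjoint A} {t : ℝ}
    (h : t ∈ eventualBounds S x) : asympSup S x ≤ t :=
  csInf_le (bddBelow_eventualBounds hS x) h

theorem mem_eventualBounds_of_asympSup_lt (hS : ∀ᶠ n in atTop, S n 1 = 1) {x : selfAdjoint A}
    {t : ℝ} (h : asympSup S x < t) : t ∈ eventualBounds S x := by
  obtain ⟨s, hs, hst⟩ := exists_lt_of_csInf_lt (nonempty_eventualBounds hS x) h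
  filter_upwards [hs] with n hn
  exact hn.trans (algebraMap_mono A hst.le)

theorem asympSup_add_le [Nontrivial A] (hS : ∀ᶠ n in atTop, S n 1 = 1) (x y : selfAdjoint A) :
    asympSup S (x + y) ≤ asympSup S x + asympSup S y := by
  refine le_of_forall_pos_le_add fun ε hε => ?_
  have hx := mem_eventualBounds_of_asympSup_lt hS (x := x) (lt_add_of_pos_right _ (half_pos hε))
  have hy := mem_eventualBounds_of_asympSup_lt hS (x := y) (lt_add_of_pos_right _ (half_pos hε))
  have := asympSup_le hS (add_mem_eventualBounds hx hy)
  linarith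

theorem asympSup_smul_le [Nontrivial A] (hS : ∀ᶠ n in atTop, S n 1 = 1) {c : ℝ} (hc : 0 < c)
    (x : selfAdjoint A) : asympSup S (c • x) ≤ c * asympSup S x := by
  refine le_of_forall_pos_le_add fun ε hε => ?_
  have hx := mem_eventualBounds_of_asympSup_lt hS (x := x) (lt_add_of_pos_right _ (div_pos hε hc))
  have := asympSup_le hS (smul_mem_eventualBounds hc.le hx)
  rwa [mul_add, mul_div_cancel₀ _ hc.ne'] at this

theorem asympSup_smul [Nontrivial A] (hS : ∀ᶠ n in atTop, S n 1 = 1) {c : ℝ} (hc : 0 < c)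
    (x : selfAdjoint A) : asympSup S (c • x) = c * asympSup S x := by
  refine (asympSup_smul_le hS hc x).antisymm ?_
  have := asympSup_smul_le hS (inv_pos.2 hc) (c • x)
  rwa [inv_smul_smul₀ hc.ne', ← div_eq_inv_mul, le_div_iff₀' hc] at this

theorem asympSup_nonpos_of_tendsto [Nontrivial A] (hS : ∀ᶠ n in atTop, S n 1 = 1)
    {x : selfAdjoint A} (h : Tendsto (fun n => S n (x : A)) atTop (𝓝 0)) :
    asympSup S x ≤ 0 := by
  refine le_of_forall_pos_le_add fun ε hε => asympSup_le hS ?_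
  filter_upwards [h.norm.eventually_lt_const (norm_zero.trans_lt hε)] with n hn
  have hsa : IsSelfAdjoint (S n (x : A)) := x.2.map (S n)
  exact hsa.le_algebraMap_norm_self.trans (algebraMap_mono A (by linarith))

/-- Every selfadjoint element admits a state which attains its asymptotic upper bound and
kills all elements that are asymptotically killed by the sequence. -/
theorem exists_state_eq_asympSup [Nontrivial A] (hS : ∀ᶠ n in atTop, S n 1 = 1)
    (x : selfAdjoint A) :
    ∃ ψ : AlgState A, ψ.toFun (x : A) = asympSup S x ∧
      ∀ y : A, Tendsto (fun n => S n y) atTop (𝓝 0) → ψ.toFun y = 0 := by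
  obtain ⟨g, hgx, hg⟩ := exists_linearMap_le_sublinear (asympSup S)
    (fun c hc x => asympSup_smul hS hc x) (asympSup_add_le hS) x
  have hle : ∀ (y : selfAdjoint A) (t : ℝ), (y : A) ≤ algebraMap ℝ A t → g y ≤ t :=
    fun y t h => (hg y).trans (asympSup_le hS (mem_eventualBounds_of_le hS h))
  have hone : g 1 = 1 := by
    have h₁ := hle 1 1 (by simp)
    have h₂ := hle (-1) (-1) (by simp)
    rw [map_neg] at h₂
    linarith
  have hpos : ∀ y : selfAdjoint A, 0 ≤ (y : A) → 0 ≤ g y := by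
    intro y hy
    have := hle (-y) 0 (by simpa using hy)
    rw [map_neg] at this
    linarith
  have hker : ∀ y : selfAdjoint A, Tendsto (fun n => S n (y : A)) atTop (𝓝 0) → g y = 0 := by
    intro y hy
    have h₁ := (hg y).trans (asympSup_nonpos_of_tendsto hS hy)
    have h₂ := (hg (-y)).trans (asympSup_nonpos_of_tendsto hS (by simpa using hy.neg))
    rw [map_neg] at h₂
    linarith
  refine ⟨stateOfSelfAdjoint g hone hpos, ?_, fun y hy => ?_⟩
  · rw [stateOfSelfAdjoint_apply, selfAdjoint.realPart_coe, x.2.imaginaryPart, hgx]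
    simp
  · have hy' : Tendsto (fun n => S n (star y)) atTop (𝓝 0) := by
      simp only [map_star]
      simpa using hy.star
    have hre : Tendsto (fun n => S n (realPart y : A)) atTop (𝓝 0) := by
      simpa [realPart_apply_coe] using (hy.add hy').const_smul (2⁻¹ : ℝ)
    have him : Tendsto (fun n => S n (imaginaryPart y : A)) atTop (𝓝 0) := by
      simpa [imaginaryPart_apply_coe] using
        ((hy.sub hy').const_smul (2⁻¹ : ℝ)).const_smul (-Complex.I)
    simp [stateOfSelfAdjoint_apply, hker _ hre, hker _ him]

/-- If `τ` is the only state which kills all asymptotically killed elements, then the sequence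
converges to `τ`. -/
theorem tendsto_of_unique_state (hS : ∀ᶠ n in atTop, S n 1 = 1) (τ : AlgState A)
    (huniq : ∀ ψ : AlgState A,
      (∀ y : A, Tendsto (fun n => S n y) atTop (𝓝 0) → ψ.toFun y = 0) → ψ.toFun = τ.toFun)
    (a : A) : Tendsto (fun n => S n a) atTop (𝓝 (τ.toFun a • 1)) := by
  have : Nontrivial A := ⟨1, 0, fun h => by simpa [h] using τ.map_one⟩
  have hsup : ∀ x : selfAdjoint A, τ.toFun (x : A) = asympSup S x := by
    intro x
    obtain ⟨ψ, hψx, hψ⟩ := exists_state_eq_asympSup hS x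
    rw [← huniq ψ hψ, hψx]
  have hsa : ∀ x : selfAdjoint A,
      Tendsto (fun n => S n (x : A)) atTop (𝓝 (τ.toFun (x : A) • 1)) := by
    intro x
    have hneg : asympSup S (-x) = -asympSup S x := by
      have := hsup (-x)
      rw [AddSubgroup.coe_neg, map_neg, hsup x] at this
      exact_mod_cast this.symm
    have hlim : τ.toFun (x : A) • (1 : A) = algebraMap ℝ A (asympSup S x) := by
      rw [hsup x, Algebra.algebraMap_eq_smul_one, Complex.coe_smul]
    rw [hlim, Metric.tendsto_atTop']
    refine fun ε hε => ?_
    have h₁ := mem_eventualBounds_of_asympSup_lt hS (x := x)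
      (lt_add_of_pos_right _ (half_pos hε))
    have h₂ := mem_eventualBounds_of_asympSup_lt hS (x := -x)
      (lt_add_of_pos_right _ (half_pos hε))
    obtain ⟨N, hN⟩ := eventually_atTop.1 (h₁.and h₂)
    refine ⟨N, fun n hn => ?_⟩
    obtain ⟨h₁, h₂⟩ := hN n hn.le
    rw [dist_eq_norm]
    refine lt_of_le_of_lt (norm_le_of_le_algebraMap ((x.2.map (S n)).sub ?_) (r := ε / 2) ?_ ?_)
      (half_lt_self hε)
    · exact (IsSelfAdjoint.all _).algebraMap A
    · rw [sub_le_iff_le_add', ← map_add]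
      exact h₁
    · rw [hneg, AddSubgroup.coe_neg, map_neg] at h₂
      rw [neg_sub, sub_eq_add_neg, ← le_sub_iff_add_le', ← map_sub]
      refine h₂.trans_eq (congrArg _ ?_)
      ring
  have hdecomp := realPart_add_I_smul_imaginaryPart a
  have := (hsa (realPart a)).add ((hsa (imaginaryPart a)).const_smul Complex.I)
  simp only [← map_smul, ← map_add, hdecomp, smul_smul, ← add_smul, ← smul_eq_mul] at this
  exact this

end AsymptoticBounds

section Cesaro

variable {A : Type*} [CStarAlgebra A] [PartialOrder A] [StarOrderedRing A]

/-- The Cesàro averages of the iterates of a positive linear map. -/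
def cesaro (T : A →ₚ[ℂ] A) (n : ℕ) : A →ₚ[ℂ] A :=
  PositiveLinearMap.mk₀ ((n : ℂ)⁻¹ • ∑ k ∈ Finset.range n, T.toLinearMap ^ k) fun x hx => by
    have hk : ∀ k : ℕ, 0 ≤ (T.toLinearMap ^ k) x := by
      intro k
      induction k with
      | zero => simpa using hx
      | succ k ih =>
        rw [pow_succ', Module.End.mul_apply]
        exact T.map_nonneg ih
    rw [LinearMap.smul_apply, LinearMap.sum_apply]
    have hn : ((n : ℂ)⁻¹) = (((n : ℝ)⁻¹ : ℝ) : ℂ) := by push_cast; rfl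
    rw [hn, Complex.coe_smul]
    exact smul_nonneg (by positivity) (Finset.sum_nonneg fun k _ => hk k)

theorem cesaro_apply (T : A →ₚ[ℂ] A) (n : ℕ) (a : A) :
    cesaro T n a = (n : ℂ)⁻¹ • ∑ k ∈ Finset.range n, T^[k] a := by
  change ((n : ℂ)⁻¹ • ∑ k ∈ Finset.range n, T.toLinearMap ^ k) a = _
  simp [LinearMap.sum_apply, Module.End.pow_apply]

theorem cesaro_eq_birkhoffAverage (T : A →ₚ[ℂ] A) (n : ℕ) (a : A) :
    cesaro T n a = birkhoffAverage ℂ T _root_.id n a :=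
  cesaro_apply T n a

theorem tendsto_cesaro_apply_sub (T : A →ₚ[ℂ] A) (hT : ∀ a, ‖T a‖ ≤ ‖a‖) (a : A) :
    Tendsto (fun n => cesaro T n (T a - a)) atTop (𝓝 0) := by
  simp only [map_sub, cesaro_eq_birkhoffAverage]
  refine tendsto_birkhoffAverage_apply_sub_birkhoffAverage ℂ ?_
  refine isBounded_iff_forall_norm_le.2 ⟨‖a‖, ?_⟩
  rintro _ ⟨k, rfl⟩
  induction k with
  | zero => simp
  | succ k ih =>
    simp only [Function.iterate_succ_apply', id_eq] at ih ⊢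
    exact (hT _).trans ih

theorem cesaro_apply_fixed (T : A →ₚ[ℂ] A) {a : A} (h : T a = a) {n : ℕ} (hn : n ≠ 0) :
    cesaro T n a = a := by
  rw [cesaro_apply]
  have hk : ∀ k, T^[k] a = a := fun k => Function.iterate_fixed h k
  simp only [hk, Finset.sum_const, Finset.card_range]
  rw [← Nat.cast_smul_eq_nsmul ℂ, inv_smul_smul₀ (Nat.cast_ne_zero.2 hn)]

theorem AlgState.cesaro_of_invariant {T : A →ₚ[ℂ] A} {τ : AlgState A}
    (hτ : ∀ a, τ.toFun (T a) = τ.toFun a) (a : A) {n : ℕ} (hn : n ≠ 0) :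
    τ.toFun (cesaro T n a) = τ.toFun a := by
  have hk : ∀ k, τ.toFun (T^[k] a) = τ.toFun a := by
    intro k
    induction k with
    | zero => rfl
    | succ k ih => rw [Function.iterate_succ_apply', hτ, ih]
  rw [cesaro_apply, map_smul, map_sum]
  simp only [hk, Finset.sum_const, Finset.card_range]
  rw [← Nat.cast_smul_eq_nsmul ℂ, inv_smul_smul₀ (Nat.cast_ne_zero.2 hn)]

/-- Unique ergodicity of a unital positive contraction: an invariant state is the only one if and
only if the Cesàro averages converge to it in norm. -/
theorem unique_invariant_iff_tendsto_cesaro (T : A →ₚ[ℂ] A) (hT : ∀ a, ‖T a‖ ≤ ‖a‖)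
    (hone : T 1 = 1) (τ : AlgState A) :
    (∀ τ' : AlgState A, (∀ a, τ'.toFun (T a) = τ'.toFun a) → ∀ a, τ'.toFun a = τ.toFun a) ↔
      ∀ a, Tendsto (fun n => cesaro T n a) atTop (𝓝 (τ.toFun a • 1)) := by
  constructor
  · intro huniq
    refine tendsto_of_unique_state ?_ τ fun ψ hψ => LinearMap.ext (huniq ψ fun a => ?_)
    · filter_upwards [eventually_ne_atTop 0] with n hn using cesaro_apply_fixed T hone hn
    · rw [← sub_eq_zero, ← map_sub]
      exact hψ _ (tendsto_cesaro_apply_sub T hT a)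
  · intro hlim τ' hτ' a
    have h₁ := (τ'.continuous.tendsto _).comp (hlim a)
    rw [map_smul, τ'.map_one, smul_eq_mul, mul_one] at h₁
    refine tendsto_nhds_unique (tendsto_const_nhds.congr' ?_) h₁
    filter_upwards [eventually_ne_atTop 0] with n hn
    exact (AlgState.cesaro_of_invariant hτ' a hn).symm

end Cesaro

section Convolution

variable {Γ : Type*} [Group Γ] {A : Type*} [CStarAlgebra A] [MulSemiringAction Γ A]
  [SMulCommClass Γ ℂ A]

/-- The star algebra endomorphism given by a group element. -/
def actionStarAlgHom (hstar : ∀ (g : Γ) (a : A), g • (star a) = star (g • a)) (g : Γ) :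
    A →⋆ₐ[ℂ] A where
  toRingHom := MulSemiringAction.toRingHom Γ A g
  commutes' := fun z => by
    change g • algebraMap ℂ A z = algebraMap ℂ A z
    rw [Algebra.algebraMap_eq_smul_one, smul_comm, smul_one]
  map_star' := hstar g

theorem norm_action_le (hstar : ∀ (g : Γ) (a : A), g • (star a) = star (g • a)) (g : Γ) (a : A) :
    ‖g • a‖ ≤ ‖a‖ :=
  NonUnitalStarAlgHom.norm_apply_le (actionStarAlgHom hstar g) a

theorem norm_conv_term_le (hstar : ∀ (g : Γ) (a : A), g • (star a) = star (g • a))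
    (μ : ProbOn Γ) (a : A) (g : Γ) : ‖(μ.w g : ℂ) • (g⁻¹ • a)‖ ≤ μ.w g * ‖a‖ := by
  rw [norm_smul, Complex.norm_real, Real.norm_of_nonneg (μ.nonneg g)]
  exact mul_le_mul_of_nonneg_left (norm_action_le hstar _ a) (μ.nonneg g)

theorem hasSum_convOp (hstar : ∀ (g : Γ) (a : A), g • (star a) = star (g • a))
    (μ : ProbOn Γ) (a : A) :
    HasSum (fun g : Γ => (μ.w g : ℂ) • (g⁻¹ • a)) (convOp μ a) :=
  (Summable.of_norm_bounded (μ.hasSum.summable.mul_right ‖a‖)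
    (norm_conv_term_le hstar μ a)).hasSum

theorem norm_convOp_le (hstar : ∀ (g : Γ) (a : A), g • (star a) = star (g • a))
    (μ : ProbOn Γ) (a : A) : ‖convOp μ a‖ ≤ ‖a‖ :=
  tsum_of_norm_bounded (by simpa using μ.hasSum.mul_right ‖a‖) (norm_conv_term_le hstar μ a)

theorem convOp_one (hstar : ∀ (g : Γ) (a : A), g • (star a) = star (g • a)) (μ : ProbOn Γ) :
    convOp μ (1 : A) = 1 := by
  refine (hasSum_convOp hstar μ 1).unique ?_
  simpa using (Complex.hasSum_ofReal.2 μ.hasSum).smul_const (1 : A)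

variable [PartialOrder A] [StarOrderedRing A]

/-- The convolution operator as a positive linear map. -/
def convPositive (hstar : ∀ (g : Γ) (a : A), g • (star a) = star (g • a)) (μ : ProbOn Γ) :
    A →ₚ[ℂ] A :=
  PositiveLinearMap.mk₀
    { toFun := convOp μ
      map_add' := fun a b => by
        refine (hasSum_convOp hstar μ (a + b)).unique ?_
        simpa only [smul_add] using (hasSum_convOp hstar μ a).add (hasSum_convOp hstar μ b)
      map_smul' := fun z a => by
        refine (hasSum_convOp hstar μ (z • a)).unique ?_
        simpa only [smul_comm _ z, RingHom.id_apply] using (hasSum_convOp hstar μ a).const_smul z }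
    fun x hx => (hasSum_convOp hstar μ x).nonneg fun g => by
      rw [Complex.coe_smul]
      exact smul_nonneg (μ.nonneg g) (map_nonneg (actionStarAlgHom hstar g⁻¹) hx)

theorem isStationaryStateAct_iff (hstar : ∀ (g : Γ) (a : A), g • (star a) = star (g • a))
    (μ : ProbOn Γ) (τ : AlgState A) :
    IsStationaryStateAct μ τ ↔ ∀ a, τ.toFun (convOp μ a) = τ.toFun a := by
  refine forall_congr' fun a => ?_
  have h : HasSum (fun g : Γ => (μ.w g : ℂ) * τ.toFun (g⁻¹ • a)) (τ.toFun (convOp μ a)) := by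
    simpa [Function.comp_def] using
      (hasSum_convOp hstar μ a).map τ.toFun.toAddMonoidHom τ.continuous
  exact ⟨fun h' => h.unique h', fun h' => h' ▸ h⟩

end Convolution

end RW

open RW in
/-- A `μ`-stationary state `τ` is the unique `μ`-stationary state iff the Cesàro averages
of the convolution powers converge in norm to `τ(a) 1`. -/
theorem unique_stationarity_iff_cesaro
    {Γ : Type*} [Group Γ] [Countable Γ]
    {A : Type*} [NormedRing A] [StarRing A] [CStarRing A] [NormedAlgebra ℂ A]
    [StarModule ℂ A] [CompleteSpace A]
    [MulSemiringAction Γ A] [SMulCommClass Γ ℂ A]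
    (hstar : ∀ (g : Γ) (a : A), g • (star a) = star (g • a))
    (μ : ProbOn Γ) (τ : AlgState A) (hτ : IsStationaryStateAct μ τ) :
    (∀ τ' : AlgState A, IsStationaryStateAct μ τ' → ∀ a : A, τ'.toFun a = τ.toFun a) ↔
    (∀ a : A,
      Tendsto (fun n : ℕ =>
          ‖(n : ℂ)⁻¹ • (∑ k ∈ Finset.range n, (convOp μ)^[k] a) - τ.toFun a • (1 : A)‖)
        atTop (nhds 0)) := by
  let _ : CStarAlgebra A := {}
  let _ : PartialOrder A := CStarAlgebra.spectralOrder A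
  have : StarOrderedRing A := CStarAlgebra.spectralOrderedRing A
  have key := unique_invariant_iff_tendsto_cesaro (convPositive hstar μ)
    (norm_convOp_le hstar μ) (convOp_one hstar μ) τ
  refine Iff.trans ?_ (key.trans ?_)
  · exact forall_congr' fun τ' => imp_congr_left (isStationaryStateAct_iff hstar μ τ')
  · refine forall_congr' fun a => ?_
    rw [tendsto_iff_norm_sub_tendsto_zero]
    simp only [cesaro_apply]
    rfl
end
end

section
/- Let μ ∈ Prob(Γ) be generating and let (X,ν) be a μ-boundary. Assume there is a Γ-Noetherian lower semilattice F in the measure algebra of ν (a Γ-invariant family of ν-equivalence classes of Borel sets closed under intersections, in which every descending chain modulo ν-null sets stabilizes) such that Fix(g) = {x ∈ X : gx = x} belongs to F for every g ∈ Γ. Then every g ∈ Γ acts on (X,ν) either trivially ν-almost everywhere (ν(Fix(g)) = 1) or essentially freely (ν(Fix(g)) = 0). -/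
noncomputable section
open scoped ComplexOrder ENNReal
open MeasureTheory Filter Topology
set_option linter.unusedSectionVars false
set_option maxHeartbeats 1000000
set_option synthInstance.maxHeartbeats 400000

namespace RW

section Meas

variable {Γ : Type*} [Group Γ] {X : Type*} [MeasurableSpace X] [MulAction Γ X]

/-- `ν` is `μ`-stationary: `ν = ∑_g μ(g) g_*ν`. -/
def IsStatMeasure (μ : ProbOn Γ) (ν : Measure X) : Prop :=
  ν = Measure.sum (fun g : Γ => ENNReal.ofReal (μ.w g) • Measure.map (fun x : X => g • x) ν)

/-- Position of the `(Γ,μ)`-random walk at time `n`, given the sequence of increments. -/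
def walk (x : ℕ → Γ) (n : ℕ) : Γ := (List.ofFn (fun i : Fin n => x i)).prod

/-- `P` is the Bernoulli measure `μ^⊗ℕ` on the space of increments of the random walk;
the path measure ℙ_μ is its push-forward under partial products. -/
def IsBernoulli [MeasurableSpace Γ] (μ : ProbOn Γ) (P : Measure (ℕ → Γ)) : Prop :=
  IsProbabilityMeasure P ∧
  ∀ (n : ℕ) (s : Fin n → Γ), P {x | ∀ i : Fin n, x (i : ℕ) = s i}
      = ∏ i, ENNReal.ofReal (μ.w (s i))

/-- Essential freeness of an action on a measure space. -/
def IsEssFree (Γ : Type*) [Group Γ] {X : Type*} [MeasurableSpace X] [MulAction Γ X]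
    (ν : Measure X) : Prop :=
  ∀ g : Γ, g ≠ 1 → ν {x : X | g • x = x} = 0

/-- Essential freeness of the restriction of the action to a subgroup. -/
def IsEssFreeOn (Λ : Subgroup Γ) (ν : Measure X) : Prop :=
  ∀ h : Γ, h ∈ Λ → h ≠ 1 → ν {x : X | h • x = x} = 0

/-- The action is non-singular: each translate of `ν` is equivalent to `ν`. -/
def IsNonSingular (Γ : Type*) [Group Γ] {X : Type*} [MeasurableSpace X] [MulAction Γ X]
    (ν : Measure X) : Prop :=
  ∀ g : Γ, Measure.map (fun x : X => g • x) ν ≪ ν ∧ ν ≪ Measure.map (fun x : X => g • x) ν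

end Meas

section TopMeas

variable {Γ : Type*} [Group Γ] {X : Type*} [TopologicalSpace X] [MeasurableSpace X] [MulAction Γ X]

/-- Weak* convergence of the pushforwards of `ν` under a sequence of group elements
to the Dirac measure at `z`. -/
def TendstoDirac (ν : Measure X) (ws : ℕ → Γ) (z : X) : Prop :=
  ∀ f : C(X, ℝ), Tendsto (fun n => ∫ y, f y ∂(Measure.map (fun x : X => ws n • x) ν))
    atTop (nhds (f z))

/-- `(X, ν)` is a `μ`-boundary: `ν` is a `μ`-stationary probability measure and for
ℙ_μ-almost every path `ω` of the random walk the measures `(ω_n)_*ν` converge weak* to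
a Dirac measure. -/
def IsMuBoundary [MeasurableSpace Γ] (μ : ProbOn Γ) (ν : Measure X) : Prop :=
  IsProbabilityMeasure ν ∧ IsStatMeasure μ ν ∧
  ∀ P : Measure (ℕ → Γ), IsBernoulli μ P →
    ∀ᵐ x ∂P, ∃ z : X, TendstoDirac ν (walk x) z

/-- `(X, ν)` is a `μ`-USB: a `μ`-boundary whose measure is the unique `μ`-stationary
probability measure on `X`. -/
def IsUSB [MeasurableSpace Γ] (μ : ProbOn Γ) (ν : Measure X) : Prop :=
  IsMuBoundary μ ν ∧
  ∀ ν' : Measure X, IsProbabilityMeasure ν' → IsStatMeasure μ ν' → ν' = ν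

/-- The support of a measure: points all of whose neighbourhoods have positive measure. -/
def msupport (ν : Measure X) : Set X := {x : X | ∀ U : Set X, IsOpen U → x ∈ U → 0 < ν U}

/-- `X` is a mean-proximal `Γ`-space: for every generating `μ` there is a unique
`μ`-stationary probability measure, and it makes `X` a `μ`-boundary. -/
def IsMeanProximal (Γ X : Type*) [Group Γ] [MeasurableSpace Γ] [TopologicalSpace X]
    [MeasurableSpace X] [MulAction Γ X] : Prop :=
  ∀ μ : ProbOn Γ, μ.Generating →
    ∃ ν : Measure X, IsMuBoundary μ ν ∧
      ∀ ν' : Measure X, IsProbabilityMeasure ν' → IsStatMeasure μ ν' → ν' = ν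

end TopMeas

end RW

namespace RW

section Stationary

variable {Γ : Type*} [Group Γ] {X : Type*} [MeasurableSpace X] [MulAction Γ X]

/-- A stationary measure for a generating `μ` is quasi-invariant. -/
lemma IsStatMeasure.preimage_null {μ : ProbOn Γ} {ν : Measure X} (hν : IsStatMeasure μ ν)
    (hsmul : ∀ g : Γ, Measurable fun x : X => g • x) (hgen : μ.Generating) (g : Γ) {N : Set X}
    (hN : ν N = 0) : ν ((fun x : X => g • x) ⁻¹' N) = 0 := by
  have step : ∀ h : Γ, 0 < μ.w h → ∀ N : Set X, ν N = 0 →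
      ν ((fun x : X => h • x) ⁻¹' N) = 0 := by
    intro h hh N hN
    obtain ⟨M, hNM, hM, hM0⟩ := exists_measurable_superset_of_null hN
    refine measure_mono_null (Set.preimage_mono hNM) ?_
    rw [hν, Measure.sum_apply _ hM, ENNReal.tsum_eq_zero] at hM0
    have := hM0 h
    rw [Measure.smul_apply, Measure.map_apply (hsmul h) hM, smul_eq_mul, mul_eq_zero] at this
    refine this.resolve_left ?_
    simpa using hh
  obtain ⟨l, -, hl, rfl⟩ := hgen g
  clear hgen
  induction l generalizing N with
  | nil => simpa using hN
  | cons a l ih =>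
    have h := ih (step a (hl a List.mem_cons_self) N hN)
      fun x hx => hl x (List.mem_cons_of_mem _ hx)
    simpa [Set.preimage, mul_smul] using h

/-- Averaging over `n`-fold products of increments preserves integrals against a stationary
measure. -/
lemma IsStatMeasure.tsum_lintegral_prod_smul (hsmul : ∀ g : Γ, Measurable fun x : X => g • x)
    {μ : ProbOn Γ} {ν : Measure X} (hν : IsStatMeasure μ ν) (n : ℕ) :
    ∀ h : X → ℝ≥0∞, Measurable h →
    ∑' s : Fin n → Γ, (∫⁻ y, h ((List.ofFn s).prod • y) ∂ν) * ∏ i, ENNReal.ofReal (μ.w (s i))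
      = ∫⁻ y, h y ∂ν := by
  have hstat : ∀ h : X → ℝ≥0∞, Measurable h →
      ∫⁻ y, h y ∂ν = ∑' g, ENNReal.ofReal (μ.w g) * ∫⁻ y, h (g • y) ∂ν := by
    intro h hh
    conv_lhs => rw [hν]
    rw [lintegral_sum_measure]
    refine tsum_congr fun g => ?_
    rw [lintegral_smul_measure, lintegral_map hh (hsmul g), smul_eq_mul]
  induction n with
  | zero =>
    intro h _
    rw [tsum_eq_single default (fun s hs => absurd (Subsingleton.elim s _) hs)]
    simp
  | succ n ih =>
    intro h hh
    rw [← (Fin.consEquiv fun _ => Γ).tsum_eq, ENNReal.tsum_prod', hstat h hh]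
    refine tsum_congr fun g => ?_
    rw [← ih (fun y => h (g • y)) (hh.comp (hsmul g)), ← ENNReal.tsum_mul_left]
    refine tsum_congr fun s => ?_
    simp only [Fin.consEquiv_apply, List.ofFn_succ, Fin.cons_zero, Fin.cons_succ, List.prod_cons,
      mul_smul, Fin.prod_univ_succ]
    ring

end Stationary

section Bernoulli

variable {Γ : Type*} [Countable Γ] [MeasurableSpace Γ] [DiscreteMeasurableSpace Γ]

lemma exists_isBernoulli (μ : ProbOn Γ) : ∃ P : Measure (ℕ → Γ), IsBernoulli μ P := by
  set m : Measure Γ := Measure.sum fun g => ENNReal.ofReal (μ.w g) • Measure.dirac g with hm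
  have hsingle : ∀ g, m {g} = ENNReal.ofReal (μ.w g) := by
    intro g
    rw [hm, Measure.sum_apply _ (measurableSet_singleton g), tsum_eq_single g]
    · simp
    · intro h hne
      simp [hne]
  have hprob : IsProbabilityMeasure m := by
    constructor
    rw [hm, Measure.sum_apply _ .univ]
    simp only [Measure.smul_apply, measure_univ, smul_eq_mul, mul_one]
    rw [← ENNReal.ofReal_tsum_of_nonneg μ.nonneg μ.hasSum.summable, μ.hasSum.tsum_eq,
      ENNReal.ofReal_one]
  refine ⟨Measure.infinitePi fun _ => m, inferInstance, fun n s => ?_⟩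
  rcases isEmpty_or_nonempty Γ with hΓ | ⟨⟨g₀⟩⟩
  · have : m = 0 := Measure.eq_zero_of_isEmpty m
    exact absurd this (IsProbabilityMeasure.ne_zero m)
  let t : ℕ → Γ := fun i => if h : i < n then s ⟨i, h⟩ else g₀
  have ht : ∀ i : Fin n, t i = s i := fun i => by simp [t]
  have hset : {x : ℕ → Γ | ∀ i : Fin n, x (i : ℕ) = s i}
      = Set.pi (Finset.range n : Set ℕ) fun i => {t i} := by
    ext x
    simp only [Set.mem_ofPred_eq, Set.mem_pi, Finset.coe_range, Set.mem_Iio,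
      Set.mem_singleton_iff]
    exact ⟨fun h i hi => (h ⟨i, hi⟩).trans (ht ⟨i, hi⟩).symm,
      fun h i => (h i i.2).trans (ht i)⟩
  rw [hset, Measure.infinitePi_pi _ (fun i _ => measurableSet_singleton _)]
  simp_rw [hsingle]
  rw [Finset.prod_range]
  simp_rw [ht]

/-- Integration of a function of the first `n` increments. -/
lemma IsBernoulli.lintegral_restrict {μ : ProbOn Γ} {P : Measure (ℕ → Γ)} (hP : IsBernoulli μ P)
    (n : ℕ) (φ : (Fin n → Γ) → ℝ≥0∞) :
    ∫⁻ x, φ (fun i => x i) ∂P = ∑' s : Fin n → Γ, φ s * ∏ i, ENNReal.ofReal (μ.w (s i)) := by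
  have hmeas : Measurable fun (x : ℕ → Γ) (i : Fin n) => x i := by fun_prop
  rw [← lintegral_map (f := φ) Measurable.of_discrete hmeas, lintegral_countable']
  refine tsum_congr fun s => ?_
  rw [Measure.map_apply hmeas (measurableSet_singleton s), ← hP.2 n s]
  congr 2
  ext x
  simp [funext_iff]

end Bernoulli

section Walk

variable {Γ : Type*} [Group Γ] [Countable Γ] [MeasurableSpace Γ] [DiscreteMeasurableSpace Γ]

lemma IsBernoulli.lintegral_walk {X : Type*} [MeasurableSpace X] [MulAction Γ X]
    (hsmul : ∀ g : Γ, Measurable fun x : X => g • x)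
    {μ : ProbOn Γ} {P : Measure (ℕ → Γ)} (hP : IsBernoulli μ P)
    {ν : Measure X} (hν : IsStatMeasure μ ν) (n : ℕ) {h : X → ℝ≥0∞} (hh : Measurable h) :
    ∫⁻ x, ∫⁻ y, h (walk x n • y) ∂ν ∂P = ∫⁻ y, h y ∂ν := by
  rw [← hν.tsum_lintegral_prod_smul hsmul n h hh]
  exact hP.lintegral_restrict n fun s => ∫⁻ y, h ((List.ofFn s).prod • y) ∂ν

lemma measurable_walk (n : ℕ) : Measurable fun x : ℕ → Γ => walk x n :=
  (Measurable.of_discrete (f := fun s : Fin n → Γ => (List.ofFn s).prod)).comp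
    (by fun_prop : Measurable fun (x : ℕ → Γ) (i : Fin n) => x i)

/-- The mean over the walk of the integrals of a bounded nonnegative function against the
translates of a stationary measure. -/
lemma IsBernoulli.integral_walk {X : Type*} [MeasurableSpace X] [MulAction Γ X]
    (hsmul : ∀ g : Γ, Measurable fun x : X => g • x)
    {μ : ProbOn Γ} {P : Measure (ℕ → Γ)} (hP : IsBernoulli μ P)
    {ν : Measure X} [IsFiniteMeasure ν] (hν : IsStatMeasure μ ν) (n : ℕ) {h : X → ℝ}
    (hh : Measurable h) (h0 : ∀ y, 0 ≤ h y) (h1 : ∀ y, h y ≤ 1) :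
    ∫ x, ∫ y, h (walk x n • y) ∂ν ∂P = ∫ y, h y ∂ν := by
  have hint : ∀ g : Γ, Integrable (fun y => h (g • y)) ν := fun g =>
    Integrable.of_bound (hh.comp (hsmul g)).aestronglyMeasurable 1
      (.of_forall fun y => by rw [Real.norm_of_nonneg (h0 _)]; exact h1 _)
  rw [integral_eq_lintegral_of_nonneg_ae (.of_forall h0) hh.aestronglyMeasurable,
    ← hP.lintegral_walk hsmul hν n hh.ennreal_ofReal,
    integral_eq_lintegral_of_nonneg_ae
      (.of_forall fun x => integral_nonneg fun y => h0 _)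
      ((Measurable.of_discrete (f := fun g : Γ => ∫ y, h (g • y) ∂ν)).comp
        (measurable_walk n)).aestronglyMeasurable]
  congr 1
  refine lintegral_congr fun x => ?_
  rw [ofReal_integral_eq_lintegral_ofReal (hint _) (.of_forall fun y => h0 _)]

end Walk

section Boundary

variable {Γ : Type*} [Group Γ] [Countable Γ] [MeasurableSpace Γ] [DiscreteMeasurableSpace Γ]
  {X : Type*} [TopologicalSpace X] [CompactSpace X] [TopologicalSpace.MetrizableSpace X]
  [MeasurableSpace X] [BorelSpace X] [MulAction Γ X]

/-- A measurable set of measure `a`, approximated in `L¹` by `f`, has variance bounded by the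
variance of `f` up to the approximation error. -/
lemma measureReal_mul_le {Y : Type*} [MeasurableSpace Y] {ν : Measure Y} [IsProbabilityMeasure ν]
    {A : Set Y} (hA : MeasurableSet A) {f : Y → ℝ} (hf : Measurable f) (h0 : ∀ y, 0 ≤ f y)
    (h1 : ∀ y, f y ≤ 1) :
    ν.real A * (1 - ν.real A) ≤
      (∫ y, f y ^ 2 ∂ν - (∫ y, f y ∂ν) ^ 2) + 4 * ∫ y, |A.indicator 1 y - f y| ∂ν := by
  have hi : Measurable (A.indicator (1 : Y → ℝ)) := measurable_one.indicator hA
  have hi01 : ∀ y, A.indicator (1 : Y → ℝ) y = 0 ∨ A.indicator (1 : Y → ℝ) y = 1 := fun y => by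
    by_cases hy : y ∈ A <;> simp [hy]
  have hId : ∀ y, |A.indicator (1 : Y → ℝ) y - f y| ≤ 1 := fun y => by
    rw [abs_le]
    rcases hi01 y with h | h <;> rw [h] <;> constructor <;> linarith [h0 y, h1 y]
  have if1 : Integrable f ν := Integrable.of_bound hf.aestronglyMeasurable 1
    (.of_forall fun y => by rw [Real.norm_of_nonneg (h0 _)]; exact h1 _)
  have if2 : Integrable (fun y => f y ^ 2) ν :=
    Integrable.of_bound (hf.pow_const 2).aestronglyMeasurable 1
      (.of_forall fun y => by
        rw [Real.norm_of_nonneg (sq_nonneg _)]; exact pow_le_one₀ (h0 y) (h1 y))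
  have iA : Integrable (A.indicator (1 : Y → ℝ)) ν := (integrable_const 1).indicator hA
  have id1 : Integrable (fun y => |A.indicator (1 : Y → ℝ) y - f y|) ν := (iA.sub if1).abs
  set d := ∫ y, |A.indicator (1 : Y → ℝ) y - f y| ∂ν with hd
  have ha : ∫ y, A.indicator (1 : Y → ℝ) y ∂ν = ν.real A := integral_indicator_one hA
  have hle1 : ν.real A ≤ ∫ y, f y ^ 2 ∂ν + 2 * d := by
    rw [← ha, hd, ← integral_const_mul, ← integral_add if2 (id1.const_mul 2)]
    refine integral_mono iA (if2.add (id1.const_mul 2)) fun y => ?_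
    simp only
    rcases hi01 y with h | h <;> rw [h]
    · positivity
    · nlinarith [le_abs_self (1 - f y), h0 y, h1 y]
  have hle2 : |ν.real A - ∫ y, f y ∂ν| ≤ d := by
    rw [← ha, ← integral_sub iA if1]
    exact abs_integral_le_integral_abs
  have hd0 : 0 ≤ d := integral_nonneg fun y => abs_nonneg _
  have hf0 : 0 ≤ ∫ y, f y ∂ν := integral_nonneg h0
  have hf1 : ∫ y, f y ∂ν ≤ 1 := by
    simpa using integral_mono if1 (integrable_const (1 : ℝ)) h1
  have hA1 : ν.real A ≤ 1 := measureReal_le_one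
  have hA0 : 0 ≤ ν.real A := measureReal_nonneg
  have := abs_le.1 hle2
  nlinarith

/-- `μ`-boundaries are strongly approximately transitive: the translates of a set of positive
measure have measure arbitrarily close to one. -/
lemma IsMuBoundary.exists_lt_preimage (hcont : ∀ g : Γ, Continuous fun x : X => g • x)
    {μ : ProbOn Γ} {ν : Measure X} (hν : IsMuBoundary μ ν) {A : Set X} (hA : MeasurableSet A)
    (hA0 : ν A ≠ 0) {c : ℝ} (hc : c < 1) :
    ∃ g : Γ, c < ν.real ((fun x : X => g • x) ⁻¹' A) := by
  by_contra! hle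
  obtain ⟨P, hP⟩ := exists_isBernoulli μ
  obtain ⟨hprob, hstat, hlim⟩ := hν
  have hPprob := hP.1
  have hsmul : ∀ g : Γ, Measurable fun x : X => g • x := fun g => (hcont g).measurable
  have hapos : 0 < ν.real A := by
    rw [measureReal_def]; exact ENNReal.toReal_pos hA0 (measure_ne_top _ _)
  set δ : ℝ := (1 - c) * ν.real A / 8 with hδ
  have hδ0 : 0 < δ := by
    have := mul_pos (sub_pos.2 hc) hapos
    positivity
  have hi : Measurable (A.indicator (1 : X → ℝ)) := measurable_one.indicator hA
  have iA : Integrable (A.indicator (1 : X → ℝ)) ν := (integrable_const 1).indicator hA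
  obtain ⟨f₀, hf₀, hf₀i⟩ := iA.exists_boundedContinuous_integral_sub_le hδ0
  let f : C(X, ℝ) := ⟨fun x => max 0 (min 1 (f₀ x)), by fun_prop⟩
  have f0 : ∀ y, 0 ≤ f y := fun y => le_max_left _ _
  have f1 : ∀ y, f y ≤ 1 := fun y => max_le zero_le_one (min_le_left _ _)
  have hfm : Measurable f := f.continuous.measurable
  have hi01 : ∀ y, A.indicator (1 : X → ℝ) y = 0 ∨ A.indicator (1 : X → ℝ) y = 1 := fun y => by
    by_cases hy : y ∈ A <;> simp [hy]
  have hd0 : ∀ y, 0 ≤ |A.indicator (1 : X → ℝ) y - f y| := fun y => abs_nonneg _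
  have hd1 : ∀ y, |A.indicator (1 : X → ℝ) y - f y| ≤ 1 := fun y => by
    rw [abs_le]
    rcases hi01 y with h | h <;> rw [h] <;> constructor <;> linarith [f0 y, f1 y]
  have hdm : Measurable fun y => |A.indicator (1 : X → ℝ) y - f y| := by
    simpa [Real.norm_eq_abs] using (hi.sub hfm).norm
  have hdle : ∫ y, |A.indicator (1 : X → ℝ) y - f y| ∂ν ≤ δ := by
    refine le_trans (integral_mono_of_nonneg (.of_forall hd0) (iA.sub hf₀i).norm
      (.of_forall fun y => ?_)) hf₀
    change |A.indicator (1 : X → ℝ) y - max 0 (min 1 (f₀ y))| ≤ |A.indicator (1 : X → ℝ) y - f₀ y|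
    have h2 := le_abs_self (1 - f₀ y)
    rcases hi01 y with h | h <;> rw [h]
    · rw [zero_sub, zero_sub, abs_neg, abs_neg, abs_of_nonneg (le_max_left _ _)]
      exact max_le (abs_nonneg _) ((min_le_right _ _).trans (le_abs_self _))
    · rw [abs_of_nonneg (sub_nonneg.2 (max_le zero_le_one (min_le_left _ _)))]
      rcases min_cases 1 (f₀ y) with ⟨hm, -⟩ | ⟨hm, -⟩ <;> rw [hm]
      · simp
      · exact (sub_le_sub_left (le_max_right _ _) _).trans h2
  have hbdd : ∀ (n : ℕ) (G : Γ → ℝ), (∀ g, |G g| ≤ 1) → Integrable (fun x => G (walk x n)) P :=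
    fun n G hG => Integrable.of_bound
      ((Measurable.of_discrete (f := G)).comp (measurable_walk n)).aestronglyMeasurable 1
      (.of_forall fun x => hG _)
  have hmean : ∀ (h : X → ℝ), Measurable h → (∀ y, 0 ≤ h y) → (∀ y, h y ≤ 1) → ∀ g : Γ,
      0 ≤ ∫ y, h (g • y) ∂ν ∧ ∫ y, h (g • y) ∂ν ≤ 1 := fun h hm h0 h1 g => by
    refine ⟨integral_nonneg fun y => h0 _, ?_⟩
    have hint : Integrable (fun y => h (g • y)) ν :=
      Integrable.of_bound (hm.comp (hsmul g)).aestronglyMeasurable 1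
        (.of_forall fun y => by rw [Real.norm_of_nonneg (h0 _)]; exact h1 _)
    simpa using integral_mono hint (integrable_const (1 : ℝ)) fun y => h1 (g • y)
  set V : Γ → ℝ := fun g => ∫ y, f (g • y) ^ 2 ∂ν - (∫ y, f (g • y) ∂ν) ^ 2 with hV
  have hV1 : ∀ g, |V g| ≤ 1 := fun g => by
    have h1 := hmean f hfm f0 f1 g
    have h2 := hmean (fun y => f y ^ 2) (hfm.pow_const 2) (fun y => sq_nonneg _)
      (fun y => pow_le_one₀ (f0 y) (f1 y)) g
    rw [abs_le]
    constructor <;> nlinarith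
  have hi1 : ∀ y, 0 ≤ A.indicator (1 : X → ℝ) y ∧ A.indicator (1 : X → ℝ) y ≤ 1 := fun y => by
    rcases hi01 y with h | h <;> rw [h] <;> norm_num
  have hpt : ∀ g : Γ, (1 - c) * ∫ y, A.indicator (1 : X → ℝ) (g • y) ∂ν
      ≤ V g + 4 * ∫ y, |A.indicator (1 : X → ℝ) (g • y) - f (g • y)| ∂ν := fun g => by
    have hind : ∫ y, A.indicator (1 : X → ℝ) (g • y) ∂ν
        = ν.real ((fun x : X => g • x) ⁻¹' A) := integral_indicator_one (hsmul g hA)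
    refine le_trans ?_ (measureReal_mul_le (ν := ν) (hsmul g hA) (hfm.comp (hsmul g))
      (fun y => f0 _) (fun y => f1 _))
    rw [hind, mul_comm]
    exact mul_le_mul_of_nonneg_left (by linarith [hle g]) measureReal_nonneg
  have hn : ∀ n, (1 - c) * ν.real A - 4 * δ ≤ ∫ x, V (walk x n) ∂P := fun n => by
    have iI := hbdd n (fun g => ∫ y, A.indicator (1 : X → ℝ) (g • y) ∂ν) fun g => by
      have := hmean _ hi (fun y => (hi1 y).1) (fun y => (hi1 y).2) g
      rw [abs_le]; constructor <;> linarith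
    have iD := hbdd n (fun g => ∫ y, |A.indicator (1 : X → ℝ) (g • y) - f (g • y)| ∂ν) fun g => by
      have := hmean _ hdm hd0 hd1 g
      rw [abs_le]; constructor <;> linarith
    have := integral_mono (iI.const_mul (1 - c)) ((hbdd n V hV1).add (iD.const_mul 4))
      fun x => hpt (walk x n)
    simp only [Pi.add_apply] at this
    rw [integral_const_mul, integral_add (hbdd n V hV1) (iD.const_mul 4), integral_const_mul,
      hP.integral_walk hsmul hstat n hi (fun y => (hi1 y).1) (fun y => (hi1 y).2),
      hP.integral_walk hsmul hstat n hdm hd0 hd1, integral_indicator_one hA] at this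
    linarith
  have hVlim : Tendsto (fun n => ∫ x, V (walk x n) ∂P) atTop (𝓝 0) := by
    rw [show (0 : ℝ) = ∫ _ : ℕ → Γ, (0 : ℝ) ∂P by simp]
    refine tendsto_integral_of_dominated_convergence (fun _ => 1)
      (fun n => (hbdd n V hV1).aestronglyMeasurable) (integrable_const _)
      (fun n => .of_forall fun x => hV1 _) ?_
    filter_upwards [hlim P hP] with x ⟨z, hz⟩
    have hmap : ∀ (h : C(X, ℝ)) (n : ℕ), ∫ y, h y ∂(ν.map fun x' : X => walk x n • x')
        = ∫ y, h (walk x n • y) ∂ν := fun h n =>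
      integral_map (hsmul _).aemeasurable h.continuous.measurable.aestronglyMeasurable
    have h1 := hz f
    have h2 := hz (f ^ 2)
    simp only [hmap] at h1 h2
    simp only [ContinuousMap.pow_apply] at h2
    simpa [hV] using h2.sub (h1.pow 2)
  have := ge_of_tendsto' hVlim hn
  linarith

end Boundary

section Noetherian

variable {X : Type*} [MeasurableSpace X]

/-- Below every non-null member of a family satisfying the descending chain condition modulo
null sets there is a minimal non-null member. -/
lemma exists_minimal_nonnull {ν : Measure X} {F : Set (Set X)}
    (hF : ∀ c : ℕ → Set X, (∀ n, c n ∈ F) → (∀ n, ν (c (n + 1) \ c n) = 0) →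
      ∃ N, ∀ n, N ≤ n → ν (symmDiff (c n) (c N)) = 0)
    {Y : Set X} (hY : Y ∈ F) (hY0 : ν Y ≠ 0) :
    ∃ M ∈ F, ν M ≠ 0 ∧ ν (M \ Y) = 0 ∧
      ∀ Z ∈ F, ν Z ≠ 0 → ν (Z \ M) = 0 → ν (M \ Z) = 0 := by
  by_contra! hcon
  have next : ∀ M : {M : Set X // M ∈ F ∧ ν M ≠ 0 ∧ ν (M \ Y) = 0},
      ∃ Z : {M : Set X // M ∈ F ∧ ν M ≠ 0 ∧ ν (M \ Y) = 0},
        ν (Z.1 \ M.1) = 0 ∧ ν (M.1 \ Z.1) ≠ 0 := by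
    rintro ⟨M, hM, hM0, hMY⟩
    obtain ⟨Z, hZ, hZ0, hZM, hMZ⟩ := hcon M hM hM0 hMY
    refine ⟨⟨Z, hZ, hZ0, measure_mono_null (fun x hx => ?_) (measure_union_null hZM hMY)⟩, hZM, hMZ⟩
    by_cases hxM : x ∈ M
    exacts [.inr ⟨hxM, hx.2⟩, .inl ⟨hx.1, hxM⟩]
  choose s hs hs' using next
  let c : ℕ → {M : Set X // M ∈ F ∧ ν M ≠ 0 ∧ ν (M \ Y) = 0} :=
    fun n => s^[n] ⟨Y, hY, hY0, by simp⟩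
  have hc : ∀ n, c (n + 1) = s (c n) := fun n => Function.iterate_succ_apply' s n _
  obtain ⟨N, hN⟩ := hF (fun n => (c n).1) (fun n => (c n).2.1) fun n => by
    rw [hc]; exact hs _
  refine hs' (c N) (measure_mono_null ?_ (hN (N + 1) N.le_succ))
  rw [← hc]
  exact Set.subset_union_right

end Noetherian

end RW

open RW in
/-- On a `μ`-boundary with a Noetherian lower semilattice containing all fixed-point
sets, every group element acts either trivially a.e. or essentially freely. -/
theorem boundary_noetherian_free_or_trivial
    {Γ : Type*} [Group Γ] [Countable Γ] [MeasurableSpace Γ] [DiscreteMeasurableSpace Γ]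
    {X : Type*} [TopologicalSpace X] [CompactSpace X] [TopologicalSpace.MetrizableSpace X]
    [MeasurableSpace X] [BorelSpace X] [MulAction Γ X]
    (hcont : ∀ g : Γ, Continuous fun x : X => g • x)
    (μ : ProbOn Γ) (hgen : μ.Generating)
    (ν : Measure X) (hbnd : IsMuBoundary μ ν)
    (F : Set (Set X))
    (hFmeas : ∀ Y ∈ F, MeasurableSet Y)
    (hFinv : ∀ (g : Γ), ∀ Y ∈ F, ∃ Z ∈ F, ν (symmDiff ((fun x : X => g • x) '' Y) Z) = 0)
    (hFcap : ∀ Y ∈ F, ∀ Z ∈ F, ∃ W ∈ F, ν (symmDiff (Y ∩ Z) W) = 0)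
    (hFnoeth : ∀ c : ℕ → Set X, (∀ n, c n ∈ F) → (∀ n, ν (c (n + 1) \ c n) = 0) →
      ∃ N, ∀ n, N ≤ n → ν (symmDiff (c n) (c N)) = 0)
    (hFix : ∀ g : Γ, {x : X | g • x = x} ∈ F) :
    ∀ g : Γ, ν {x : X | g • x = x} = 1 ∨ ν {x : X | g • x = x} = 0 := by
  have hsmul : ∀ g : Γ, Measurable fun x : X => g • x := fun g => (hcont g).measurable
  have hprob : IsProbabilityMeasure ν := hbnd.1
  have hnull : ∀ (g : Γ) {N : Set X}, ν N = 0 → ν ((fun x : X => g • x) ⁻¹' N) = 0 :=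
    fun g _ hN => hbnd.2.1.preimage_null hsmul hgen g hN
  intro g
  refine or_iff_not_imp_right.2 fun hg => ?_
  obtain ⟨M, hM, hM0, hMg, hmin⟩ := exists_minimal_nonnull hFnoeth (hFix g) hg
  have hMm := hFmeas M hM
  -- a translate meeting the minimal set `M` in a non-null set contains it
  have hdich : ∀ k : Γ, ν (M ∩ (fun x : X => k • x) ⁻¹' M) ≠ 0 →
      ν (M \ (fun x : X => k • x) ⁻¹' M) = 0 := by
    intro k hk
    obtain ⟨Z, hZ, hZk⟩ := hFinv k⁻¹ M hM
    obtain ⟨W, hW, hWZ⟩ := hFcap M hM Z hZ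
    rw [Set.image_smul, ← Set.preimage_smul] at hZk
    have hZk' : (fun x : X => k • x) ⁻¹' M =ᵐ[ν] Z := measure_symmDiff_eq_zero_iff.1 hZk
    have hWk : W =ᵐ[ν] (M ∩ (fun x : X => k • x) ⁻¹' M : Set X) :=
      (measure_symmDiff_eq_zero_iff.1 hWZ).symm.trans
        (ae_eq_set_inter (ae_eq_refl M) hZk'.symm)
    have hWM := hmin W hW (by rwa [measure_congr hWk])
      (by
        rw [measure_congr (hWk.diff (ae_eq_refl M))]
        exact measure_mono_null (fun x hx => hx.2 hx.1.1) (measure_empty (μ := ν)))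
    rw [measure_congr ((ae_eq_refl M).diff hWk)] at hWM
    simpa using hWM
  have hle : ∀ a b : Γ, 1 / 2 < ν.real ((fun x : X => a • x) ⁻¹' M) →
      1 / 2 < ν.real ((fun x : X => b • x) ⁻¹' M) →
      ν.real ((fun x : X => a • x) ⁻¹' M) ≤ ν.real ((fun x : X => b • x) ⁻¹' M) := by
    intro a b ha hb
    have hcomp : (fun x : X => a • x) ⁻¹' ((fun x : X => (b * a⁻¹) • x) ⁻¹' M)
        = (fun x : X => b • x) ⁻¹' M := by
      ext x
      simp [mul_smul]
    have hne : ν (M ∩ (fun x : X => (b * a⁻¹) • x) ⁻¹' M) ≠ 0 := by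
      intro h0
      have h := hnull a h0
      rw [Set.preimage_inter, hcomp] at h
      have hu := measureReal_union_add_inter (μ := ν) (s := (fun x : X => a • x) ⁻¹' M)
        (hsmul b hMm)
      rw [measureReal_def ν (_ ∩ _), h] at hu
      have : ν.real ((fun x : X => a • x) ⁻¹' M ∪ (fun x : X => b • x) ⁻¹' M) ≤ 1 :=
        measureReal_le_one
      simp only [ENNReal.toReal_zero] at hu
      linarith
    have h := hnull a (hdich _ hne)
    rw [Set.preimage_sdiff, hcomp] at h
    rw [measureReal_def, measureReal_def]
    exact ENNReal.toReal_mono (measure_ne_top _ _) (measure_mono_ae (ae_le_set.2 h))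
  obtain ⟨a, ha⟩ := hbnd.exists_lt_preimage hcont hMm hM0 (c := 1 / 2) (by norm_num)
  have ha1 : ν.real ((fun x : X => a • x) ⁻¹' M) = 1 := by
    refine le_antisymm measureReal_le_one (le_of_not_gt fun hlt => ?_)
    obtain ⟨b, hb⟩ := hbnd.exists_lt_preimage hcont hMm hM0 hlt
    exact absurd (hle b a (ha.trans hb) ha) (not_le.2 hb)
  have hac : ν ((fun x : X => a • x) ⁻¹' Mᶜ) = 0 := by
    rw [Set.preimage_compl, prob_compl_eq_zero_iff (hsmul a hMm), ← ENNReal.toReal_eq_one_iff]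
    exact ha1
  have hMc : ν Mᶜ = 0 := by
    have h := hnull a⁻¹ hac
    simpa [← Set.preimage_comp, Function.comp_def] using h
  rw [← prob_compl_eq_zero_iff (hFmeas _ (hFix g))]
  refine measure_mono_null (fun x hx => ?_) (measure_union_null hMc hMg)
  by_cases hxM : x ∈ M
  exacts [.inr ⟨hxM, hx⟩, .inl hxM]
end
end
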